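/- Suppose F : ℝⁿ → ℂ is continuous near x₀ and satisfies F(x) = γ (x − x₀)^β / β! + o(|x − x₀|^{|β|}) as x → x₀, for a multi-index β. Then the distribution f := ∂^β F satisfies f(x₀ + ε·) → γ in 𝒟'(ℝⁿ) as ε → 0⁺, i.e., for every φ ∈ C_c^∞(ℝⁿ), ⟨f(x₀ + εx), φ(x)⟩ → γ ∫ φ. -/

import Mathlib

open MeasureTheory Filter Topology Asymptotics

/-- The partial derivative in the `i`-th coordinate direction. -/
noncomputable def pderivCoord {n : ℕ} (i : Fin n) (g : (Fin n → ℝ) → ℂ) :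
    (Fin n → ℝ) → ℂ :=
  fun x => fderiv ℝ g x (Pi.single i 1)

/-- The mixed partial derivative `∂^β` associated to a multi-index `β`. -/
noncomputable def multiDeriv {n : ℕ} (β : Fin n → ℕ) :
    ((Fin n → ℝ) → ℂ) → ((Fin n → ℝ) → ℂ) :=
  (List.finRange n).foldr (fun i T => (pderivCoord i)^[β i] ∘ T) id

section MultiDeriv

variable {n : ℕ} {φ : (Fin n → ℝ) → ℂ}

theorem ContDiff.pderivCoord (hφ : ContDiff ℝ (⊤ : ℕ∞) φ) (i : Fin n) :
    ContDiff ℝ (⊤ : ℕ∞) (pderivCoord i φ) :=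
  (hφ.fderiv_right (by exact_mod_cast le_top)).clm_apply contDiff_const

theorem HasCompactSupport.pderivCoord (hφ : HasCompactSupport φ) (i : Fin n) :
    HasCompactSupport (pderivCoord i φ) :=
  hφ.fderiv_apply ℝ _

theorem ContDiff.iterate_pderivCoord (hφ : ContDiff ℝ (⊤ : ℕ∞) φ) (i : Fin n) (k : ℕ) :
    ContDiff ℝ (⊤ : ℕ∞) ((_root_.pderivCoord i)^[k] φ) := by
  induction k with
  | zero => exact hφ
  | succ k ih => rw [Function.iterate_succ_apply']; exact ih.pderivCoord i

theorem HasCompactSupport.iterate_pderivCoord (hφ : HasCompactSupport φ) (i : Fin n) (k : ℕ) :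
    HasCompactSupport ((_root_.pderivCoord i)^[k] φ) := by
  induction k with
  | zero => exact hφ
  | succ k ih => rw [Function.iterate_succ_apply']; exact ih.pderivCoord i

/-- The mixed partial derivative along the coordinates in a list, with multiplicities `β`. -/
noncomputable def listDeriv (β : Fin n → ℕ) (l : List (Fin n)) :
    ((Fin n → ℝ) → ℂ) → ((Fin n → ℝ) → ℂ) :=
  l.foldr (fun i T => (pderivCoord i)^[β i] ∘ T) id

theorem listDeriv_cons (β : Fin n → ℕ) (i : Fin n) (l : List (Fin n))
    (φ : (Fin n → ℝ) → ℂ) :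
    listDeriv β (i :: l) φ = (pderivCoord i)^[β i] (listDeriv β l φ) :=
  rfl

theorem multiDeriv_eq_listDeriv (β : Fin n → ℕ) (φ : (Fin n → ℝ) → ℂ) :
    multiDeriv β φ = listDeriv β (List.finRange n) φ :=
  rfl

theorem ContDiff.listDeriv (hφ : ContDiff ℝ (⊤ : ℕ∞) φ) (β : Fin n → ℕ) (l : List (Fin n)) :
    ContDiff ℝ (⊤ : ℕ∞) (listDeriv β l φ) := by
  induction l with
  | nil => exact hφ
  | cons i l ih => exact ih.iterate_pderivCoord i (β i)

theorem HasCompactSupport.listDeriv (hφ : HasCompactSupport φ) (β : Fin n → ℕ)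
    (l : List (Fin n)) : HasCompactSupport (listDeriv β l φ) := by
  induction l with
  | nil => exact hφ
  | cons i l ih => exact ih.iterate_pderivCoord i (β i)

/-- Integration by parts against `x_i ^ k * q`, where `q` does not depend on `x_i`. -/
theorem integral_coord_pow_mul_iterate_pderivCoord (hφ : ContDiff ℝ (⊤ : ℕ∞) φ)
    (hφc : HasCompactSupport φ) (i : Fin n) {q : (Fin n → ℝ) → ℂ}
    (hq : ContDiff ℝ (⊤ : ℕ∞) q) (hqi : ∀ x, fderiv ℝ q x (Pi.single i 1) = 0) (k : ℕ) :
    ∫ x, ((x i : ℂ) ^ k * q x) * (pderivCoord i)^[k] φ x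
      = (-1) ^ k * (k.factorial : ℂ) * ∫ x, q x * φ x := by
  induction k with
  | zero => simp
  | succ k ih =>
    set ψ := (pderivCoord i)^[k] φ
    have hψ : ContDiff ℝ (⊤ : ℕ∞) ψ := hφ.iterate_pderivCoord i k
    have hψc : HasCompactSupport ψ := hφc.iterate_pderivCoord i k
    have hcoord (x : Fin n → ℝ) : HasFDerivAt (fun x : Fin n → ℝ => (x i : ℂ))
        (Complex.ofRealCLM.comp (ContinuousLinearMap.proj i)) x :=
      (Complex.ofRealCLM.comp (ContinuousLinearMap.proj (R := ℝ) (φ := fun _ : Fin n => ℝ) i)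
        ).hasFDerivAt
    have hqd : Differentiable ℝ q := hq.differentiable (by simp)
    have hprod (x : Fin n → ℝ) :=
      HasFDerivAt.fun_mul ((hcoord x).pow (k + 1)) (hqd x).hasFDerivAt
    have hderiv (x : Fin n → ℝ) :
        fderiv ℝ (fun x : Fin n → ℝ => (x i : ℂ) ^ (k + 1) * q x) x (Pi.single i 1)
          = (k + 1 : ℂ) * ((x i : ℂ) ^ k * q x) := by
      rw [(hprod x).fderiv]
      simp [hqi]
      ring
    have hp : Differentiable ℝ (fun x : Fin n → ℝ => (x i : ℂ) ^ (k + 1) * q x) := fun x =>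
      (hprod x).differentiableAt
    have hparts := integral_mul_fderiv_eq_neg_fderiv_mul_of_integrable (μ := volume)
      (f := fun x : Fin n → ℝ => (x i : ℂ) ^ (k + 1) * q x) (g := ψ) (v := Pi.single i 1)
      ?_ ?_ ?_ (fun x _ => hp x) (fun x _ => hψ.differentiable (by simp) x)
    · rw [Function.iterate_succ_apply']
      refine hparts.trans ?_
      simp_rw [hderiv, mul_assoc ((k : ℂ) + 1)]
      rw [integral_const_mul, ih, Nat.factorial_succ]
      push_cast
      ring
    · simp_rw [hderiv]
      have hcont := hq.continuous
      have hψcont := hψ.continuous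
      exact Continuous.integrable_of_hasCompactSupport (by fun_prop) hψc.mul_left
    · exact (hp.continuous.mul (hψ.pderivCoord i).continuous).integrable_of_hasCompactSupport
        (hψc.pderivCoord i).mul_left
    · exact (hp.continuous.mul hψ.continuous).integrable_of_hasCompactSupport hψc.mul_left

theorem contDiff_list_prod_coord_pow (β : Fin n → ℕ) (l : List (Fin n)) :
    ContDiff ℝ (⊤ : ℕ∞)
      (fun x : Fin n → ℝ => (l.map fun j => (x j : ℂ) ^ β j).prod) := by
  induction l with
  | nil => simpa using contDiff_const
  | cons i l ih =>
    simp only [List.map_cons, List.prod_cons]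
    exact ((Complex.ofRealCLM.contDiff.comp (contDiff_apply ℝ ℝ i)).pow _).mul ih

theorem fderiv_list_prod_coord_pow_of_notMem (β : Fin n → ℕ) {l : List (Fin n)} {i : Fin n}
    (hi : i ∉ l) (x : Fin n → ℝ) :
    fderiv ℝ (fun x : Fin n → ℝ => (l.map fun j => (x j : ℂ) ^ β j).prod) x (Pi.single i 1)
      = 0 := by
  rw [← ((contDiff_list_prod_coord_pow β l).differentiable (by simp) x).lineDeriv_eq_fderiv,
    lineDeriv]
  have hconst (t : ℝ) : (l.map fun j => (((x + t • Pi.single i 1 : Fin n → ℝ) j : ℝ) : ℂ) ^ β j)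
      = l.map fun j => (x j : ℂ) ^ β j := by
    refine List.map_congr_left fun j hj => ?_
    have hji : j ≠ i := fun h => hi (h ▸ hj)
    simp [hji]
  simp_rw [hconst]
  exact deriv_const _ _

theorem integral_list_prod_coord_pow_mul_listDeriv (hφ : ContDiff ℝ (⊤ : ℕ∞) φ)
    (hφc : HasCompactSupport φ) (β : Fin n → ℕ) {l : List (Fin n)} (hl : l.Nodup) :
    ∫ x, (l.map fun j => (x j : ℂ) ^ β j).prod * listDeriv β l φ x
      = (l.map fun j => (-1) ^ β j * ((β j).factorial : ℂ)).prod * ∫ x, φ x := by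
  induction l with
  | nil => simp [listDeriv]
  | cons i l ih =>
    obtain ⟨hi, hl⟩ := List.nodup_cons.mp hl
    simp only [List.map_cons, List.prod_cons, listDeriv_cons]
    rw [integral_coord_pow_mul_iterate_pderivCoord (hφ.listDeriv β l) (hφc.listDeriv β l) i
      (contDiff_list_prod_coord_pow β l) (fderiv_list_prod_coord_pow_of_notMem β hi), ih hl]
    ring

/-- Integrating the monomial `x ^ β` against `∂^β φ` gives `(-1) ^ |β| β! ∫ φ`. -/
theorem integral_monomial_mul_multiDeriv (hφ : ContDiff ℝ (⊤ : ℕ∞) φ)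
    (hφc : HasCompactSupport φ) (β : Fin n → ℕ) :
    ∫ x, (∏ i, (x i : ℂ) ^ β i) * multiDeriv β φ x
      = (-1) ^ (∑ i, β i) * (∏ i, ((β i).factorial : ℂ)) * ∫ x, φ x := by
  have h := integral_list_prod_coord_pow_mul_listDeriv hφ hφc β (List.nodup_finRange n)
  simp_rw [← List.ofFn_eq_map, List.prod_ofFn] at h
  rw [multiDeriv_eq_listDeriv, h, Finset.prod_mul_distrib, Finset.prod_pow_eq_pow_sum]

end MultiDeriv

section Scaling

variable {n : ℕ} {F P ψ : (Fin n → ℝ) → ℂ} {x₀ : Fin n → ℝ}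

theorem MeasureTheory.LocallyIntegrable.integrable_mul_dilation (hF : LocallyIntegrable F)
    (hψ : Continuous ψ) (hψc : HasCompactSupport ψ) (x₀ : Fin n → ℝ) {ε : ℝ} (hε : 0 < ε) :
    Integrable fun x => F (x₀ + ε • x) * ψ x := by
  let e : (Fin n → ℝ) ≃ₜ (Fin n → ℝ) :=
    (Homeomorph.smulOfNeZero ε hε.ne').trans (Homeomorph.addLeft x₀)
  have he (x : Fin n → ℝ) : e x = x₀ + ε • x := rfl
  have h := hF.integrable_smul_left_of_hasCompactSupport (hψ.comp e.symm.continuous)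
    (hψc.comp_homeomorph e.symm)
  have h2 := (h.comp_add_left x₀).comp_smul hε.ne'
  refine h2.congr (.of_forall fun x => ?_)
  simp only [← he, Function.comp_apply, e.symm_apply_apply, smul_eq_mul, mul_comm]

theorem integral_mul_comp_sub_div (F ψ : (Fin n → ℝ) → ℂ) (x₀ : Fin n → ℝ) {ε : ℝ}
    (hε : 0 < ε) :
    ∫ y, F y * ψ (fun i => (y i - x₀ i) / ε) = ε ^ n • ∫ x, F (x₀ + ε • x) * ψ x := by
  rw [← integral_add_left_eq_self _ x₀]
  have h := Measure.integral_comp_inv_smul_of_nonneg (volume : Measure (Fin n → ℝ))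
    (fun x => F (x₀ + ε • x) * ψ x) hε.le
  rw [Module.finrank_fin_fun] at h
  rw [← h]
  refine integral_congr_ae (.of_forall fun x => ?_)
  have hx : (fun i => ((x₀ + x) i - x₀ i) / ε) = ε⁻¹ • x := by
    ext i
    simp [div_eq_inv_mul]
  simp only [hx, smul_inv_smul₀ hε.ne']

/-- If `F` is asymptotic to a function `P (· - x₀)`, with `P` homogeneous of degree `m`,
then the rescalings of `F` at `x₀` converge to `P` in the sense of distributions. -/
theorem tendsto_integral_rescale_of_isLittleO (hF : LocallyIntegrable F) (hP : Continuous P)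
    {m : ℕ} (hPm : ∀ (ε : ℝ) x, P (ε • x) = (ε : ℂ) ^ m * P x)
    (hFP : (fun x => F x - P (x - x₀)) =o[𝓝 x₀] fun x => ‖x - x₀‖ ^ m)
    (hψ : Continuous ψ) (hψc : HasCompactSupport ψ) :
    Tendsto (fun ε : ℝ => ∫ x, ((ε : ℂ) ^ m)⁻¹ * (F (x₀ + ε • x) * ψ x))
      (𝓝[>] 0) (𝓝 (∫ x, P x * ψ x)) := by
  have hpos : ∀ᶠ ε : ℝ in 𝓝[>] 0, 0 < ε := self_mem_nhdsWithin
  -- the rescaled remainder, uniformly on the support of `ψ`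
  have hrem {c : ℝ} (hc : 0 < c) : ∀ᶠ ε : ℝ in 𝓝[>] 0, ∀ x ∈ tsupport ψ,
      ‖((ε : ℂ) ^ m)⁻¹ * F (x₀ + ε • x) - P x‖ ≤ c * ‖x‖ ^ m := by
    have hnear : ∀ᶠ ε : ℝ in 𝓝 0, ∀ x ∈ tsupport ψ,
        ‖F (x₀ + ε • x) - P (x₀ + ε • x - x₀)‖ ≤ c * ‖‖x₀ + ε • x - x₀‖ ^ m‖ := by
      refine hψc.isCompact.eventually_forall_of_forall_eventually fun x _ => ?_
      have ht : Tendsto (fun z : ℝ × (Fin n → ℝ) => x₀ + z.1 • z.2) (𝓝 (0, x)) (𝓝 x₀) := by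
        have : Continuous fun z : ℝ × (Fin n → ℝ) => x₀ + z.1 • z.2 := by fun_prop
        simpa using this.tendsto (0, x)
      exact ht.eventually (hFP.def hc)
    filter_upwards [hpos, hnear.filter_mono nhdsWithin_le_nhds] with ε hε h x hx
    have hεm : (ε : ℂ) ^ m ≠ 0 := pow_ne_zero _ (by exact_mod_cast hε.ne')
    have h1 := h x hx
    rw [add_sub_cancel_left, hPm] at h1
    have h2 : ((ε : ℂ) ^ m)⁻¹ * F (x₀ + ε • x) - P x
        = ((ε : ℂ) ^ m)⁻¹ * (F (x₀ + ε • x) - (ε : ℂ) ^ m * P x) := by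
      field_simp
    have hεpow : 0 < ε ^ m := pow_pos hε m
    rw [h2, norm_mul, norm_inv, norm_pow, Complex.norm_real, Real.norm_of_nonneg hε.le,
      inv_mul_le_iff₀ hεpow]
    refine h1.trans_eq ?_
    rw [norm_smul, Real.norm_of_nonneg hε.le, mul_pow, Real.norm_of_nonneg (by positivity)]
    ring
  refine tendsto_integral_filter_of_dominated_convergence
    (fun x => (‖x‖ ^ m + ‖P x‖) * ‖ψ x‖) ?_ ?_ ?_ ?_
  · filter_upwards [hpos] with ε hε
    exact ((hF.integrable_mul_dilation hψ hψc x₀ hε).const_mul _).aestronglyMeasurable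
  · filter_upwards [hrem one_pos] with ε h
    refine .of_forall fun x => ?_
    by_cases hx : x ∈ tsupport ψ
    · rw [← mul_assoc, norm_mul]
      gcongr
      have := norm_le_norm_sub_add (((ε : ℂ) ^ m)⁻¹ * F (x₀ + ε • x)) (P x)
      linarith [h x hx]
    · simp [image_eq_zero_of_notMem_tsupport hx]
  · exact Continuous.integrable_of_hasCompactSupport (by fun_prop) hψc.norm.mul_left
  · refine .of_forall fun x => ?_
    by_cases hx : x ∈ tsupport ψ
    · simp_rw [← mul_assoc]
      refine Tendsto.mul_const _ (Metric.tendsto_nhds.mpr fun δ hδ => ?_)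
      have hden : 0 < ‖x‖ ^ m + 1 := by positivity
      filter_upwards [hrem (div_pos hδ hden)] with ε h
      rw [dist_eq_norm]
      refine (h x hx).trans_lt ?_
      rw [div_mul_eq_mul_div, div_lt_iff₀ hden]
      linarith
    · simp [image_eq_zero_of_notMem_tsupport hx]

end Scaling

theorem point_value_of_primitive_asymptotics (n : ℕ) (β : Fin n → ℕ)
    (F : (Fin n → ℝ) → ℂ) (γ : ℂ) (x₀ : Fin n → ℝ)
    (hFli : LocallyIntegrable F)
    (hFc : ∀ᶠ x in 𝓝 x₀, ContinuousAt F x)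
    (hasymp : (fun x => F x - γ * (↑(∏ i, (x i - x₀ i) ^ β i) : ℂ) /
        (↑(∏ i, Nat.factorial (β i)) : ℂ))
      =o[𝓝 x₀] fun x => ‖x - x₀‖ ^ (∑ i, β i)) :
    ∀ φ : (Fin n → ℝ) → ℂ, ContDiff ℝ (⊤ : ℕ∞) φ → HasCompactSupport φ →
      Tendsto (fun ε : ℝ =>
          ((-1 : ℝ) ^ (∑ i, β i) * ε ^ (-((n : ℝ) + (∑ i, β i)))) •
            ∫ y, F y * multiDeriv β φ (fun i => (y i - x₀ i) / ε))
        (𝓝[>] 0) (𝓝 (γ * ∫ x, φ x)) := by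
  intro φ hφ hφc
  have hψ : Continuous (multiDeriv β φ) := (hφ.listDeriv β (List.finRange n)).continuous
  have hψc : HasCompactSupport (multiDeriv β φ) := hφc.listDeriv β (List.finRange n)
  set m := ∑ i, β i with hm
  have hβ : (∏ i, ((β i).factorial : ℂ)) ≠ 0 :=
    Finset.prod_ne_zero_iff.mpr fun i _ => by exact_mod_cast (β i).factorial_ne_zero
  let P : (Fin n → ℝ) → ℂ := fun x =>
    γ / (∏ i, ((β i).factorial : ℂ)) * ∏ i, (x i : ℂ) ^ β i
  have hP : Continuous P := by fun_prop
  have hPm (ε : ℝ) (x : Fin n → ℝ) : P (ε • x) = (ε : ℂ) ^ m * P x := by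
    simp only [P, Pi.smul_apply, smul_eq_mul, Complex.ofReal_mul, mul_pow,
      Finset.prod_mul_distrib, Finset.prod_pow_eq_pow_sum, ← hm]
    ring
  have hFP : (fun x => F x - P (x - x₀)) =o[𝓝 x₀] fun x => ‖x - x₀‖ ^ m := by
    refine hasymp.congr_left fun x => ?_
    simp only [P, Pi.sub_apply]
    push_cast
    ring
  have hlim := (tendsto_integral_rescale_of_isLittleO hFli hP hPm hFP hψ hψc).const_mul
    ((-1 : ℂ) ^ m)
  have hval : (-1 : ℂ) ^ m * ∫ x, P x * multiDeriv β φ x = γ * ∫ x, φ x := by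
    simp only [P, mul_assoc]
    rw [integral_const_mul, integral_monomial_mul_multiDeriv hφ hφc β, ← hm]
    have hsign : (-1 : ℂ) ^ m * (-1) ^ m = 1 := by rw [← mul_pow]; simp
    field_simp
    linear_combination (γ * ∫ x, φ x) * hsign
  rw [hval] at hlim
  refine hlim.congr' ?_
  filter_upwards [self_mem_nhdsWithin] with ε (hε : 0 < ε)
  have hεc : (ε : ℂ) ≠ 0 := by exact_mod_cast hε.ne'
  have hpow : ε ^ (-((n : ℝ) + m)) = (ε ^ n)⁻¹ * (ε ^ m)⁻¹ := by
    rw [Real.rpow_neg hε.le, Real.rpow_add hε, Real.rpow_natCast, Real.rpow_natCast, mul_inv]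
  rw [integral_mul_comp_sub_div F _ x₀ hε, integral_const_mul, Complex.real_smul,
    Complex.real_smul]
  push_cast [hm] at hpow ⊢
  rw [hpow]
  push_cast
  field_simp
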